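/- There exist functions ε_ω : ℝ → ℝ and δ_ω : ℝ → ℝ³ converging to 0 locally uniformly on ℝ as ω → ∞, and remainders r_ω : ℝ → ℝ³ with ω·r_ω → 0 locally uniformly as ω → ∞, such that for all t ∈ ℝ: x_ω(t) = x₀ + ∫₀ᵗ (h(s) + ε_ω(s)) b(x_ω(s)) ds + (b(x(t)) × v_ω(t))/(ω |B(x(t))|) + (1/ω)[ (v₀ × b(x₀))/|B(x₀)| + ∫₀ᵗ (b(x_ω(s))/|B(x(s))|) × ( μ₀ ∇|B|(x(s)) + h(s)² κ(x(s)) + δ_ω(s) ) ds ] + r_ω(t). -/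

import Mathlib

open MeasureTheory Filter RealInnerProductSpace

noncomputable section

abbrev E3 := EuclideanSpace ℝ (Fin 3)

/-- Cross product on `E3`. -/
def cross (u v : E3) : E3 :=
  !₂[u 1 * v 2 - u 2 * v 1, u 2 * v 0 - u 0 * v 2, u 0 * v 1 - u 1 * v 0]

/-- Partial derivative of `f` in the `i`-th coordinate direction. -/
def pd (f : E3 → E3) (i : Fin 3) (x : E3) : E3 := fderiv ℝ f x (EuclideanSpace.single i 1)

/-- Curl of a vector field. -/
def curl (f : E3 → E3) (x : E3) : E3 :=
  !₂[pd f 1 x 2 - pd f 2 x 1, pd f 2 x 0 - pd f 0 x 2, pd f 0 x 1 - pd f 1 x 0]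

/-- Divergence of a vector field. -/
def divergence (f : E3 → E3) (x : E3) : ℝ := ∑ i, pd f i x i
/-- Convergence in $C^{0,\alpha}_{loc}$ as $\omega\to\infty$: for every compact
$K\subset\mathbb{R}$ the $\alpha$-Hölder norm of $f_\omega - g$ on $K$ tends to $0$
(both the sup part and the Hölder seminorm part become arbitrarily small). -/
def HolderLocConv {E : Type*} [NormedAddCommGroup E] (f : ℝ → ℝ → E) (g : ℝ → E)
    (α : ℝ) : Prop :=
  ∀ K : Set ℝ, IsCompact K → ∀ ε > 0, ∃ W : ℝ, ∀ ω ≥ W,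
    (∀ t ∈ K, ‖f ω t - g t‖ ≤ ε) ∧
    ∀ s ∈ K, ∀ t ∈ K, ‖(f ω s - g s) - (f ω t - g t)‖ ≤ ε * |s - t| ^ α

open scoped Topology

/-- The cross product as a continuous bilinear map. -/
def crossL : E3 →L[ℝ] E3 →L[ℝ] E3 :=
  (LinearMap.mk₂ ℝ cross
    (by intros; ext i; fin_cases i <;> simp [cross] <;> ring)
    (by intros; ext i; fin_cases i <;> simp [cross] <;> ring)
    (by intros; ext i; fin_cases i <;> simp [cross] <;> ring)
    (by intros; ext i; fin_cases i <;> simp [cross] <;> ring)).toContinuousBilinearMap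

lemma crossL_apply (u v : E3) : crossL u v = cross u v := rfl

lemma inner_eq_coord (u v : E3) : ⟪u, v⟫ = u 0 * v 0 + u 1 * v 1 + u 2 * v 2 := by
  simp [PiLp.inner_apply, Fin.sum_univ_three, mul_comm]

lemma norm_sq_eq_coord (u : E3) : ‖u‖ ^ 2 = u 0 * u 0 + u 1 * u 1 + u 2 * u 2 := by
  rw [← real_inner_self_eq_norm_sq, inner_eq_coord]

lemma inner_cross_self_left (u v : E3) : ⟪u, cross u v⟫ = 0 := by
  simp [inner_eq_coord, cross]; ring

lemma inner_cross_self_right (u v : E3) : ⟪cross u v, v⟫ = 0 := by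
  simp [inner_eq_coord, cross]; ring

lemma cross_smul_left (a : ℝ) (u v : E3) : cross (a • u) v = a • cross u v := by
  simp [← crossL_apply]

lemma cross_smul_right (a : ℝ) (u v : E3) : cross u (a • v) = a • cross u v := by
  simp [← crossL_apply]

lemma cross_cross_right (u v : E3) : cross (cross u v) v = ⟪u, v⟫ • v - ‖v‖ ^ 2 • u := by
  ext i; fin_cases i <;> simp [norm_sq_eq_coord, inner_eq_coord, cross] <;> ring

lemma cross_cross_left (u v : E3) : cross v (cross u v) = ‖v‖ ^ 2 • u - ⟪u, v⟫ • v := by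
  ext i; fin_cases i <;> simp [norm_sq_eq_coord, inner_eq_coord, cross] <;> ring

lemma cross_eq_neg_cross (u v : E3) : cross u v = -cross v u := by
  ext i; fin_cases i <;> simp [cross] <;> ring

lemma eq_sum_smul_single (a : E3) :
    a = ∑ i, a i • (EuclideanSpace.single i (1 : ℝ) : E3) := by
  ext j; fin_cases j <;> simp [Fin.sum_univ_three]

section Bilinear

variable {F : Type*} [NormedAddCommGroup F] [NormedSpace ℝ F]

/-- The trace of a bilinear map on `E3`. -/
def bilinTrace (M : E3 →L[ℝ] E3 →L[ℝ] F) : F :=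
  ∑ i, M (EuclideanSpace.single i 1) (EuclideanSpace.single i 1)

lemma bilin_eq_sum (M : E3 →L[ℝ] E3 →L[ℝ] F) (a c : E3) :
    M a c = ∑ i, ∑ j, (a i * c j) •
      M (EuclideanSpace.single i 1) (EuclideanSpace.single j 1) := by
  conv_lhs => rw [eq_sum_smul_single a, eq_sum_smul_single c]
  rw [map_sum M, sum_apply]
  simp only [map_sum, map_smul, smul_apply, smul_smul, mul_comm]

lemma bilinTrace_eq_sum (M : E3 →L[ℝ] E3 →L[ℝ] F) :
    bilinTrace M = ∑ i, ∑ j, (if i = j then (1 : ℝ) else 0) •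
      M (EuclideanSpace.single i 1) (EuclideanSpace.single j 1) := by
  simp [bilinTrace]

/-- The gyroaverage of `M v v` over velocities `v` with parallel component `u` along the unit
vector `b` and squared length `e`. -/
def gyroAverage (M : E3 →L[ℝ] E3 →L[ℝ] F) (b : E3) (u e : ℝ) : F :=
  u ^ 2 • M b b + ((e - u ^ 2) / 2) • (bilinTrace M - M b b)

lemma continuous_gyroAverage {X : Type*} [TopologicalSpace X] {M : X → E3 →L[ℝ] E3 →L[ℝ] F}
    {b : X → E3} {u : X → ℝ} (hM : Continuous M) (hb : Continuous b) (hu : Continuous u) (e : ℝ) :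
    Continuous fun p => gyroAverage (M p) (b p) (u p) e := by
  simp only [gyroAverage, bilinTrace]; fun_prop

/-- `v × b` and the component of `v` orthogonal to `b` are orthogonal vectors of equal length
spanning the plane orthogonal to `b`. -/
lemma bilin_cross_add_bilin_perp (M : E3 →L[ℝ] E3 →L[ℝ] F) {b : E3} (hb : ‖b‖ = 1) (v : E3) :
    M (cross v b) (cross v b) + M (v - ⟪v, b⟫ • b) (v - ⟪v, b⟫ • b) =
      (‖v‖ ^ 2 - ⟪v, b⟫ ^ 2) • (bilinTrace M - M b b) := by
  have h1 : b 0 * b 0 + b 1 * b 1 + b 2 * b 2 = 1 := by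
    rw [← norm_sq_eq_coord, hb, one_pow]
  rw [bilinTrace_eq_sum, bilin_eq_sum M (cross v b), bilin_eq_sum M (v - _), bilin_eq_sum M b,
    ← Finset.sum_add_distrib, ← Finset.sum_sub_distrib, Finset.smul_sum]
  refine Finset.sum_congr rfl fun i _ => ?_
  rw [← Finset.sum_add_distrib, ← Finset.sum_sub_distrib, Finset.smul_sum]
  refine Finset.sum_congr rfl fun j _ => ?_
  rw [← add_smul, ← sub_smul, smul_smul]
  congr 1
  have key : cross v b i * cross v b j + (v - ⟪v, b⟫ • b) i * (v - ⟪v, b⟫ • b) j -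
      (‖v‖ ^ 2 - ⟪v, b⟫ ^ 2) * ((if i = j then 1 else 0) - b i * b j) =
      (‖v‖ ^ 2 * (if i = j then 1 else 0) - v i * v j) *
        (b 0 * b 0 + b 1 * b 1 + b 2 * b 2 - 1) := by
    fin_cases i <;> fin_cases j <;>
      simp [norm_sq_eq_coord, inner_eq_coord, cross] <;> ring
  rwa [h1, sub_self, mul_zero, sub_eq_zero] at key

end Bilinear

section ContinuousConvergence

variable {E F : Type*} [NormedAddCommGroup E] [NormedAddCommGroup F]

/-- Continuous convergence as the parameter tends to infinity; for a continuous limit this is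
locally uniform convergence. -/
def ContinuouslyConverges (G : ℝ → ℝ → E) (g : ℝ → E) : Prop :=
  ∀ t, Tendsto (fun p : ℝ × ℝ => G p.1 p.2) (atTop ×ˢ 𝓝 t) (𝓝 (g t))

lemma ContinuouslyConverges.tendstoLocallyUniformly_zero {G : ℝ → ℝ → E}
    (hG : ContinuouslyConverges G fun _ => 0) :
    TendstoLocallyUniformly G (fun _ => (0 : E)) atTop := by
  rw [tendstoLocallyUniformly_iff_forall_tendsto]
  intro t
  exact (tendsto_const_nhds.prodMk_nhds (hG t)).mono_right (nhds_le_uniformity 0)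

lemma continuouslyConverges_const {g : ℝ → E} (hg : Continuous g) :
    ContinuouslyConverges (fun _ => g) g :=
  fun t => (hg.tendsto t).comp tendsto_snd

lemma eventually_param_pos (t : ℝ) : ∀ᶠ p : ℝ × ℝ in atTop ×ˢ 𝓝 t, 0 < p.1 :=
  tendsto_fst.eventually (eventually_gt_atTop 0)

lemma ContinuouslyConverges.congr' {G G' : ℝ → ℝ → E} {g : ℝ → E}
    (hG : ContinuouslyConverges G g) (h : ∀ ω > 0, ∀ t, G ω t = G' ω t) :
    ContinuouslyConverges G' g := fun t =>
  (hG t).congr' ((eventually_param_pos t).mono fun p hp => h p.1 hp p.2)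

lemma ContinuouslyConverges.add {G G' : ℝ → ℝ → E} {g g' : ℝ → E}
    (hG : ContinuouslyConverges G g) (hG' : ContinuouslyConverges G' g') :
    ContinuouslyConverges (fun ω t => G ω t + G' ω t) (fun t => g t + g' t) :=
  fun t => (hG t).add (hG' t)

lemma ContinuouslyConverges.sub {G G' : ℝ → ℝ → E} {g g' : ℝ → E}
    (hG : ContinuouslyConverges G g) (hG' : ContinuouslyConverges G' g') :
    ContinuouslyConverges (fun ω t => G ω t - G' ω t) (fun t => g t - g' t) :=
  fun t => (hG t).sub (hG' t)

lemma ContinuouslyConverges.comp_continuous {G : ℝ → ℝ → E} {g : ℝ → E}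
    (hG : ContinuouslyConverges G g) {φ : E → F} (hφ : Continuous φ) :
    ContinuouslyConverges (fun ω t => φ (G ω t)) (fun t => φ (g t)) :=
  fun t => (hφ.tendsto _).comp (hG t)

lemma ContinuouslyConverges.prodMk {G : ℝ → ℝ → E} {g : ℝ → E} {H : ℝ → ℝ → F} {k : ℝ → F}
    (hG : ContinuouslyConverges G g) (hH : ContinuouslyConverges H k) :
    ContinuouslyConverges (fun ω t => (G ω t, H ω t)) (fun t => (g t, k t)) :=
  fun t => (hG t).prodMk_nhds (hH t)

lemma continuouslyConverges_zero_of_norm_le {G : ℝ → ℝ → E} {H : ℝ → ℝ → ℝ}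
    (hH : ContinuouslyConverges H fun _ => 0) (h : ∀ ω > 0, ∀ t, ‖G ω t‖ ≤ H ω t) :
    ContinuouslyConverges G fun _ => 0 := fun t =>
  squeeze_zero_norm' ((eventually_param_pos t).mono fun p hp => h p.1 hp p.2) (hH t)

/-- A family bounded on each bounded time interval by a multiple of the inverse parameter
converges to zero. -/
lemma continuouslyConverges_zero_of_norm_le_div {G : ℝ → ℝ → E}
    (h : ∀ T, ∃ C, ∀ ω > 0, ∀ t, |t| ≤ T → ‖G ω t‖ ≤ C / ω) :
    ContinuouslyConverges G fun _ => 0 := by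
  intro t
  obtain ⟨C, hC⟩ := h (|t| + 1)
  have hT : ∀ᶠ s in 𝓝 t, |s| ≤ |t| + 1 :=
    (continuous_abs.tendsto t).eventually (Iic_mem_nhds (lt_add_one _))
  refine squeeze_zero_norm' (a := fun p : ℝ × ℝ => C / p.1) ?_
    ((tendsto_const_nhds.div_atTop tendsto_id).comp tendsto_fst)
  filter_upwards [eventually_param_pos t, tendsto_snd.eventually hT] with p hp hpT
  exact hC _ hp _ hpT

/-- Continuous convergence yields uniform estimates on bounded intervals. -/
lemma ContinuouslyConverges.eventually_norm_le {G : ℝ → ℝ → E}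
    (hG : ContinuouslyConverges G fun _ => 0) (T : ℝ) {η : ℝ} (hη : 0 < η) :
    ∀ᶠ ω in atTop, ∀ t, |t| ≤ T → ‖G ω t‖ ≤ η := by
  have h := (tendstoLocallyUniformly_iff_forall_isCompact.mp hG.tendstoLocallyUniformly_zero)
    (Set.Icc (-T) T) isCompact_Icc
  rw [Metric.tendstoUniformlyOn_iff] at h
  filter_upwards [h η hη] with ω hω t ht
  simpa using (hω t (abs_le.mp ht)).le

lemma ContinuouslyConverges.unique {G : ℝ → ℝ → E} {g g' : ℝ → E}
    (hG : ContinuouslyConverges G g) (hG' : ContinuouslyConverges G g') : g = g' :=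
  funext fun t => tendsto_nhds_unique (hG t) (hG' t)

lemma ContinuouslyConverges.eval {G : ℝ → ℝ → E} {g : ℝ → E} (hG : ContinuouslyConverges G g)
    (t₀ : ℝ) : ContinuouslyConverges (fun ω _ => G ω t₀) fun _ => g t₀ := by
  intro t
  have h : Tendsto (fun p : ℝ × ℝ => (p.1, t₀)) (atTop ×ˢ 𝓝 t) (atTop ×ˢ 𝓝 t₀) :=
    tendsto_fst.prodMk tendsto_const_nhds
  exact (hG t₀).comp h

variable [NormedSpace ℝ E]

lemma ContinuouslyConverges.integral_zero {G : ℝ → ℝ → E}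
    (hG : ContinuouslyConverges G fun _ => 0) :
    ContinuouslyConverges (fun ω t => ∫ s in (0 : ℝ)..t, G ω s) fun _ => 0 := by
  intro t
  rw [Metric.tendsto_nhds]
  intro η hη
  have hT : ∀ᶠ s in 𝓝 t, |s| ≤ |t| + 1 :=
    (continuous_abs.tendsto t).eventually (Iic_mem_nhds (lt_add_one _))
  have hη' : 0 < η / (|t| + 2) := by positivity
  filter_upwards [tendsto_fst.eventually (hG.eventually_norm_le (|t| + 1) hη'),
    tendsto_snd.eventually hT] with p hp hp'
  rw [dist_zero_right]
  calc ‖∫ s in (0 : ℝ)..p.2, G p.1 s‖ ≤ η / (|t| + 2) * |p.2 - 0| :=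
        intervalIntegral.norm_integral_le_of_norm_le_const fun s hs => hp s ?_
    _ ≤ η / (|t| + 2) * (|t| + 1) := by rw [sub_zero]; gcongr
    _ < η := by
      rw [div_mul_eq_mul_div, div_lt_iff₀ (by positivity)]
      nlinarith
  have h1 := Set.abs_sub_left_of_mem_uIcc (Set.uIoc_subset_uIcc hs)
  simp only [sub_zero] at h1
  exact h1.trans hp'

lemma ContinuouslyConverges.integral {G : ℝ → ℝ → E} {g : ℝ → E}
    (hG : ContinuouslyConverges G g) (hGc : ∀ ω > 0, Continuous (G ω)) (hg : Continuous g) :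
    ContinuouslyConverges (fun ω t => ∫ s in (0 : ℝ)..t, G ω s)
      (fun t => ∫ s in (0 : ℝ)..t, g s) := by
  have h0 : ContinuouslyConverges (fun ω t => G ω t - g t) fun _ => 0 := by
    simpa using hG.sub (continuouslyConverges_const hg)
  have h1 := h0.integral_zero.add (continuouslyConverges_const
    (intervalIntegral.continuous_primitive (μ := volume) (fun a b => hg.intervalIntegrable a b) 0))
  simp only [zero_add] at h1
  refine h1.congr' fun ω hω t => ?_
  rw [intervalIntegral.integral_sub ((hGc ω hω).intervalIntegrable _ _)
    (hg.intervalIntegrable _ _), sub_add_cancel]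

/-- A locally equi-Lipschitz family whose primitives converge to zero converges to zero. -/
lemma ContinuouslyConverges.of_integral {d : ℝ → ℝ → ℝ}
    (hd : ContinuouslyConverges (fun ω t => ∫ s in (0 : ℝ)..t, d ω s) fun _ => 0)
    (hc : ∀ ω > 0, Continuous (d ω))
    (hL : ∀ T, ∃ C, ∀ ω > 0, ∀ s t, |s| ≤ T → |t| ≤ T → |d ω s - d ω t| ≤ C * |s - t|) :
    ContinuouslyConverges d fun _ => 0 := by
  intro t
  rw [Metric.tendsto_nhds]
  intro η hη
  obtain ⟨C, hC⟩ := hL (|t| + 2)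
  have hT : ∀ᶠ s in 𝓝 t, |s| ≤ |t| + 1 :=
    (continuous_abs.tendsto t).eventually (Iic_mem_nhds (lt_add_one _))
  set τ : ℝ := min 1 (η / (4 * (|C| + 1))) with hτdef
  have hτ : 0 < τ := lt_min one_pos (by positivity)
  have hτ1 : τ ≤ 1 := min_le_left _ _
  have hCτ : |C| * τ ≤ η / 4 := by
    calc |C| * τ ≤ (|C| + 1) * (η / (4 * (|C| + 1))) := by
          gcongr
          · linarith
          · exact min_le_right _ _
      _ = η / 4 := by field_simp
  filter_upwards [eventually_param_pos t, tendsto_snd.eventually hT,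
    tendsto_fst.eventually (hd.eventually_norm_le (|t| + 2) (η := η * τ / 8) (by positivity))]
    with p hω hs hI
  obtain ⟨ω, s⟩ := p
  simp only at hω hs hI ⊢
  rw [dist_zero_right, Real.norm_eq_abs]
  have hsτ : |s + τ| ≤ |t| + 2 := (abs_add_le _ _).trans (by rw [abs_of_pos hτ]; linarith)
  have hi : ∀ a b, IntervalIntegrable (d ω) volume a b := (hc ω hω).intervalIntegrable
  have e1 : ∫ r in s..s + τ, d ω r =
      (∫ r in (0 : ℝ)..s + τ, d ω r) - ∫ r in (0 : ℝ)..s, d ω r :=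
    (intervalIntegral.integral_interval_sub_left (hi _ _) (hi _ _)).symm
  have e2 : ∫ r in s..s + τ, (d ω r - d ω s) = (∫ r in s..s + τ, d ω r) - τ * d ω s := by
    rw [intervalIntegral.integral_sub (hi _ _) (by simp)]
    simp
  have b1 : |∫ r in s..s + τ, (d ω r - d ω s)| ≤ |C| * τ * |s + τ - s| := by
    rw [← Real.norm_eq_abs]
    refine intervalIntegral.norm_integral_le_of_norm_le_const fun r hr => ?_
    rw [Set.uIoc_of_le (by linarith)] at hr
    have hr' : |r| ≤ |t| + 2 := by
      have : |r - s| ≤ 1 := by rw [abs_of_pos] <;> linarith [hr.1, hr.2]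
      calc |r| = |(r - s) + s| := by ring_nf
        _ ≤ _ := (abs_add_le _ _).trans (by linarith)
    have hrs : |r - s| ≤ τ := by rw [abs_of_pos] <;> linarith [hr.1, hr.2]
    calc ‖d ω r - d ω s‖ ≤ C * |r - s| := hC ω hω r s hr' (by linarith)
      _ ≤ |C| * τ := mul_le_mul (le_abs_self C) hrs (abs_nonneg _) (abs_nonneg _)
  rw [add_sub_cancel_left, abs_of_pos hτ] at b1
  have b2 := hI (s + τ) hsτ
  have b3 := hI s (by linarith)
  rw [Real.norm_eq_abs] at b2 b3
  have b4 : |C| * τ * τ ≤ η / 4 * τ := by gcongr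
  have b5 : τ * |d ω s| < τ * η := by
    rw [← abs_of_pos hτ, ← abs_mul, abs_of_pos hτ, abs_lt]
    rw [abs_le] at b1 b2 b3
    constructor <;> nlinarith [mul_pos hη hτ, b1.1, b1.2, b2.1, b2.2, b3.1, b3.2]
  exact lt_of_mul_lt_mul_left b5 hτ.le

end ContinuousConvergence

section Trajectory

/-- `y` solves the normalized Lorentz equation with velocity `v` and the given initial data. -/
structure IsLorentzTrajectory (B : E3 → E3) (x₀ v₀ : E3) (ω : ℝ) (y v : ℝ → E3) : Prop where
  hasDerivAt_pos : ∀ t, HasDerivAt y (v t) t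
  hasDerivAt_vel : ∀ t, HasDerivAt v (ω • cross (v t) (B (y t))) t
  pos_zero : y 0 = x₀
  vel_zero : v 0 = v₀

namespace IsLorentzTrajectory

variable {B : E3 → E3} {x₀ v₀ : E3} {ω : ℝ} {y v : ℝ → E3}

lemma continuous_pos (hy : IsLorentzTrajectory B x₀ v₀ ω y v) : Continuous y :=
  continuous_iff_continuousAt.mpr fun t => (hy.hasDerivAt_pos t).continuousAt

lemma continuous_vel (hy : IsLorentzTrajectory B x₀ v₀ ω y v) : Continuous v :=
  continuous_iff_continuousAt.mpr fun t => (hy.hasDerivAt_vel t).continuousAt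

/-- Conservation of kinetic energy. -/
lemma norm_vel (hy : IsLorentzTrajectory B x₀ v₀ ω y v) (t : ℝ) : ‖v t‖ = ‖v₀‖ := by
  have hd : ∀ s, HasDerivAt (fun s => ‖v s‖ ^ 2) 0 s := fun s => by
    have := (hy.hasDerivAt_vel s).norm_sq
    rwa [inner_smul_right, inner_cross_self_left, mul_zero, mul_zero] at this
  have := is_const_of_deriv_eq_zero (fun s => (hd s).differentiableAt)
    (fun s => (hd s).deriv) t 0
  rw [hy.vel_zero] at this
  exact (sq_eq_sq₀ (norm_nonneg _) (norm_nonneg _)).mp this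

lemma norm_pos_sub_le (hy : IsLorentzTrajectory B x₀ v₀ ω y v) (t : ℝ) :
    ‖y t - x₀‖ ≤ ‖v₀‖ * |t| := by
  have := convex_univ.norm_image_sub_le_of_norm_hasDerivWithin_le (C := ‖v₀‖) (x := 0) (y := t)
    (fun s _ => (hy.hasDerivAt_pos s).hasDerivWithinAt) (fun s _ => (hy.norm_vel s).le)
    (Set.mem_univ _) (Set.mem_univ _)
  rwa [hy.pos_zero, sub_zero, Real.norm_eq_abs] at this

end IsLorentzTrajectory

variable {B : E3 → E3} {x₀ v₀ : E3} {y v : ℝ → ℝ → E3}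
  {F : Type*} [NormedAddCommGroup F]

/-- Continuous phase space functions are bounded along all trajectories on bounded intervals. -/
lemma exists_bound_along (hy : ∀ ω > 0, IsLorentzTrajectory B x₀ v₀ ω (y ω) (v ω))
    {Ψ : E3 × E3 → F} (hΨ : Continuous Ψ) (T : ℝ) :
    ∃ C, ∀ ω > 0, ∀ t, |t| ≤ T → ‖Ψ (y ω t, v ω t)‖ ≤ C := by
  obtain ⟨C, hC⟩ := ((isCompact_closedBall x₀ (‖v₀‖ * T)).prod
    (isCompact_closedBall (0 : E3) ‖v₀‖)).exists_bound_of_continuousOn hΨ.continuousOn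
  refine ⟨C, fun ω hω t ht => hC _ ⟨?_, ?_⟩⟩
  · rw [mem_closedBall_iff_norm]
    exact ((hy ω hω).norm_pos_sub_le t).trans (by gcongr)
  · rw [mem_closedBall_zero_iff]
    exact ((hy ω hω).norm_vel t).le

variable [NormedSpace ℝ F]

/-- Derivatives along the gyration average out. -/
lemma continuouslyConverges_integral_fderiv [CompleteSpace F]
    (hy : ∀ ω > 0, IsLorentzTrajectory B x₀ v₀ ω (y ω) (v ω)) (hB : Continuous B)
    {Φ : E3 × E3 → F} (hΦ : ContDiff ℝ 1 Φ) :
    ContinuouslyConverges (fun ω t => ∫ s in (0 : ℝ)..t,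
      fderiv ℝ Φ (y ω s, v ω s) (0, cross (v ω s) (B (y ω s)))) fun _ => 0 := by
  have hD : Continuous (fderiv ℝ Φ) := hΦ.continuous_fderiv one_ne_zero
  have hcr : Continuous fun p : E3 × E3 => cross p.2 (B p.1) := by
    simp only [← crossL_apply]; fun_prop
  refine continuouslyConverges_zero_of_norm_le_div fun T => ?_
  obtain ⟨C₀, hC₀⟩ := exists_bound_along hy hΦ.continuous T
  obtain ⟨C₁, hC₁⟩ := exists_bound_along hy
    (Ψ := fun p => fderiv ℝ Φ p (p.2, 0)) (by fun_prop) T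
  refine ⟨C₀ + C₀ + C₁ * T, fun ω hω t ht => ?_⟩
  have hyω := hy ω hω
  have hp : Continuous fun s => (y ω s, v ω s) := hyω.continuous_pos.prodMk hyω.continuous_vel
  set P : ℝ → F := fun s => fderiv ℝ Φ (y ω s, v ω s) (v ω s, 0) with hP
  set Q : ℝ → F := fun s => fderiv ℝ Φ (y ω s, v ω s) (0, cross (v ω s) (B (y ω s))) with hQ
  have hPc : Continuous P := by
    have : Continuous fun p : E3 × E3 => fderiv ℝ Φ p (p.2, 0) := by fun_prop
    exact this.comp hp
  have hQc : Continuous Q := by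
    have : Continuous fun p : E3 × E3 => fderiv ℝ Φ p (0, cross p.2 (B p.1)) := by fun_prop
    exact this.comp hp
  have hder : ∀ s, HasDerivAt (fun s => Φ (y ω s, v ω s)) (P s + ω • Q s) s := fun s => by
    have := (hΦ.differentiable one_ne_zero (y ω s, v ω s)).hasFDerivAt.comp_hasDerivAt s
      ((hyω.hasDerivAt_pos s).prodMk (hyω.hasDerivAt_vel s))
    have hsum : P s + ω • Q s = fderiv ℝ Φ (y ω s, v ω s)
        (v ω s, ω • cross (v ω s) (B (y ω s))) := by
      simp only [hP, hQ]
      rw [← map_smul, ← map_add]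
      simp
    rwa [hsum]
  have hftc := intervalIntegral.integral_eq_sub_of_hasDerivAt (a := 0) (b := t)
    (fun s _ => hder s) ((hPc.add (hQc.const_smul ω)).intervalIntegrable _ _)
  have hQi : IntervalIntegrable (fun s => ω • Q s) volume 0 t :=
    (hQc.const_smul ω).intervalIntegrable _ _
  rw [intervalIntegral.integral_add (hPc.intervalIntegrable _ _) hQi,
    intervalIntegral.integral_smul] at hftc
  have hPb : ‖∫ s in (0 : ℝ)..t, P s‖ ≤ C₁ * |t - 0| :=
    intervalIntegral.norm_integral_le_of_norm_le_const fun s hs => hC₁ ω hω s (by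
      have h1 := Set.abs_sub_left_of_mem_uIcc (Set.uIoc_subset_uIcc hs)
      simp only [sub_zero] at h1
      exact h1.trans ht)
  have hT : 0 ≤ T := (abs_nonneg t).trans ht
  have hC₁0 : 0 ≤ C₁ := (norm_nonneg _).trans (hC₁ ω hω 0 (by simpa using hT))
  rw [le_div_iff₀ hω, mul_comm, ← abs_of_pos hω, ← Real.norm_eq_abs, ← norm_smul,
    eq_sub_of_add_eq' hftc]
  refine (norm_sub_le _ _).trans (add_le_add ((norm_sub_le _ _).trans
    (add_le_add (hC₀ ω hω t ht) (hC₀ ω hω 0 (by simpa using hT)))) (hPb.trans ?_))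
  rw [sub_zero]
  gcongr

variable {b : E3 → E3}

/-- The phase space function whose derivative along the gyration is the oscillating part of
`M y v v`. -/
def gyroPotential (B b : E3 → E3) (M : E3 → E3 →L[ℝ] E3 →L[ℝ] F) (p : E3 × E3) : F :=
  -‖B p.1‖⁻¹ • ((1 / 2 : ℝ) • M p.1 p.2 (crossL p.2 (b p.1))
    + (1 / 2 : ℝ) • ⟪p.2, b p.1⟫ • M p.1 (b p.1) (crossL p.2 (b p.1))
    + ⟪p.2, b p.1⟫ • M p.1 (crossL p.2 (b p.1)) (b p.1))

lemma contDiff_gyroPotential (hB : ContDiff ℝ 1 B) (hne : ∀ y, B y ≠ 0) (hb : ContDiff ℝ 1 b)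
    {M : E3 → E3 →L[ℝ] E3 →L[ℝ] F} (hM : ContDiff ℝ 1 M) :
    ContDiff ℝ 1 (gyroPotential B b M) := by
  have hN : ContDiff ℝ 1 fun p : E3 × E3 => ‖B p.1‖⁻¹ :=
    ((hB.norm ℝ hne).inv fun y => norm_ne_zero_iff.mpr (hne y)).comp contDiff_fst
  have hb' : ContDiff ℝ 1 fun p : E3 × E3 => b p.1 := hb.comp contDiff_fst
  have hM' : ContDiff ℝ 1 fun p : E3 × E3 => M p.1 := hM.comp contDiff_fst
  have hc : ContDiff ℝ 1 fun p : E3 × E3 => crossL p.2 (b p.1) :=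
    (crossL.contDiff.comp contDiff_snd).clm_apply hb'
  have hu : ContDiff ℝ 1 fun p : E3 × E3 => ⟪p.2, b p.1⟫ := contDiff_snd.inner ℝ hb'
  have h1 := (hM'.clm_apply contDiff_snd).clm_apply hc
  have h2 := (hM'.clm_apply hb').clm_apply hc
  have h3 := (hM'.clm_apply hc).clm_apply hb'
  exact hN.neg.smul (((h1.const_smul (1 / 2 : ℝ)).add ((hu.smul h2).const_smul (1 / 2 : ℝ))).add
    (hu.smul h3))

lemma fderiv_gyroPotential (hB : ContDiff ℝ 1 B) (hne : ∀ y, B y ≠ 0) (hb : ContDiff ℝ 1 b)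
    (hb1 : ∀ y, ‖b y‖ = 1) (hBb : ∀ y, B y = ‖B y‖ • b y)
    {M : E3 → E3 →L[ℝ] E3 →L[ℝ] F} (hM : ContDiff ℝ 1 M) (y v : E3) :
    fderiv ℝ (gyroPotential B b M) (y, v) (0, cross v (B y)) =
      M y v v - gyroAverage (M y) (b y) ⟪v, b y⟫ (‖v‖ ^ 2) := by
  set p := cross v (B y) with hp
  have hline : HasDerivAt (fun s : ℝ => v + s • p) p 0 := by
    simpa using ((hasDerivAt_id (0 : ℝ)).smul_const p).const_add v
  have h1 : HasDerivAt (fun s : ℝ => gyroPotential B b M (y, v + s • p))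
      (fderiv ℝ (gyroPotential B b M) (y, v) (0, p)) 0 :=
    (((contDiff_gyroPotential hB hne hb hM).differentiable one_ne_zero
      (y, v)).hasFDerivAt).comp_hasDerivAt_of_eq 0 ((hasDerivAt_const 0 y).prodMk hline) (by simp)
  have hc : HasDerivAt (fun s : ℝ => crossL (v + s • p) (b y)) (crossL p (b y)) 0 :=
    (crossL.flip (b y)).hasFDerivAt.comp_hasDerivAt (0 : ℝ) hline
  have hu : HasDerivAt (fun s : ℝ => ⟪v + s • p, b y⟫) ⟪p, b y⟫ 0 := by
    simpa using hline.inner ℝ (hasDerivAt_const 0 (b y))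
  have hA : HasDerivAt (fun s : ℝ => M y (v + s • p)) (M y p) 0 :=
    (M y).hasFDerivAt.comp_hasDerivAt (0 : ℝ) hline
  have hC : HasDerivAt (fun s : ℝ => M y (crossL (v + s • p) (b y))) (M y (crossL p (b y))) 0 :=
    (M y).hasFDerivAt.comp_hasDerivAt (0 : ℝ) hc
  have e1 := hA.clm_apply hc
  have e2 : HasDerivAt (fun s : ℝ => M y (b y) (crossL (v + s • p) (b y)))
      (M y (b y) (crossL p (b y))) 0 := (M y (b y)).hasFDerivAt.comp_hasDerivAt (0 : ℝ) hc
  have e3 := hC.clm_apply (hasDerivAt_const (0 : ℝ) (b y))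
  have h2 := (((e1.const_smul (1 / 2 : ℝ)).add ((hu.smul e2).const_smul (1 / 2 : ℝ))).add
    (hu.smul e3)).const_smul (-‖B y‖⁻¹)
  rw [h1.unique h2]
  have hN : ‖B y‖ ≠ 0 := norm_ne_zero_iff.mpr (hne y)
  have hpn : p = ‖B y‖ • cross v (b y) := by
    rw [hp, ← cross_smul_right, ← hBb]
  have hpb : crossL p (b y) = ‖B y‖ • (⟪v, b y⟫ • b y - v) := by
    rw [crossL_apply, hpn, cross_smul_left, cross_cross_right, hb1]; simp
  have hpu : ⟪p, b y⟫ = 0 := by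
    rw [hpn, inner_smul_left, inner_cross_self_right, mul_zero]
  have key := eq_sub_of_add_eq (bilin_cross_add_bilin_perp (M y) (hb1 y) v)
  rw [hpb, hpu]
  simp only [zero_smul, add_zero, map_zero]
  rw [hpn, crossL_apply]
  simp only [map_smul, map_sub, smul_apply, sub_apply, key, gyroAverage]
  match_scalars <;> field_simp <;> ring

/-- The gyroaveraging principle. -/
lemma continuouslyConverges_integral_bilin [CompleteSpace F]
    (hy : ∀ ω > 0, IsLorentzTrajectory B x₀ v₀ ω (y ω) (v ω)) (hB : ContDiff ℝ 1 B)
    (hne : ∀ y, B y ≠ 0) (hb : ContDiff ℝ 1 b)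
    (hb1 : ∀ y, ‖b y‖ = 1) (hBb : ∀ y, B y = ‖B y‖ • b y)
    {M : E3 → E3 →L[ℝ] E3 →L[ℝ] F} (hM : ContDiff ℝ 1 M)
    {x : ℝ → E3} {h : ℝ → ℝ} (hx : Continuous x) (hh : Continuous h)
    (hyx : ContinuouslyConverges y x)
    (huh : ContinuouslyConverges (fun ω t => ⟪v ω t, b (y ω t)⟫) h) :
    ContinuouslyConverges (fun ω t => ∫ s in (0 : ℝ)..t, M (y ω s) (v ω s) (v ω s))
      (fun t => ∫ s in (0 : ℝ)..t, gyroAverage (M (x s)) (b (x s)) (h s) (‖v₀‖ ^ 2)) := by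
  have hbc := hb.continuous
  have hMc := hM.continuous
  have hav : Continuous fun p : E3 × ℝ => gyroAverage (M p.1) (b p.1) p.2 (‖v₀‖ ^ 2) :=
    continuous_gyroAverage (hMc.comp continuous_fst) (hbc.comp continuous_fst) continuous_snd _
  have hac : ∀ ω > 0, Continuous fun s =>
      gyroAverage (M (y ω s)) (b (y ω s)) ⟪v ω s, b (y ω s)⟫ (‖v₀‖ ^ 2) := fun ω hω => by
    have h1 := (hy ω hω).continuous_pos
    have h2 := (hy ω hω).continuous_vel
    exact hav.comp (h1.prodMk (h2.inner (hbc.comp h1)))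
  have h1 := (hyx.prodMk huh).comp_continuous hav
  have h2 := h1.integral hac (hav.comp (hx.prodMk hh))
  have h3 := continuouslyConverges_integral_fderiv hy hB.continuous
    (contDiff_gyroPotential hB hne hb hM)
  have h4 := h3.add h2
  simp only [zero_add] at h4
  refine h4.congr' fun ω hω t => ?_
  have c1 := (hy ω hω).continuous_pos
  have c2 := (hy ω hω).continuous_vel
  have e : ∀ s, fderiv ℝ (gyroPotential B b M) (y ω s, v ω s) (0, cross (v ω s) (B (y ω s))) =
      M (y ω s) (v ω s) (v ω s) -
        gyroAverage (M (y ω s)) (b (y ω s)) ⟪v ω s, b (y ω s)⟫ (‖v₀‖ ^ 2) := fun s => by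
    rw [fderiv_gyroPotential hB hne hb hb1 hBb hM, (hy ω hω).norm_vel]
  simp only [e]
  rw [intervalIntegral.integral_sub (Continuous.intervalIntegrable (by fun_prop) _ _)
    ((hac ω hω).intervalIntegrable _ _), sub_add_cancel]


lemma IsLorentzTrajectory.hasDerivAt_inner {ω : ℝ} {y v : ℝ → E3}
    (hy : IsLorentzTrajectory B x₀ v₀ ω y v) (hb : Differentiable ℝ b)
    (hBb : ∀ y, B y = ‖B y‖ • b y) (t : ℝ) :
    HasDerivAt (fun t => ⟪v t, b (y t)⟫) ⟪v t, fderiv ℝ b (y t) (v t)⟫ t := by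
  have h1 := (hy.hasDerivAt_vel t).inner ℝ
    ((hb (y t)).hasFDerivAt.comp_hasDerivAt t (hy.hasDerivAt_pos t))
  rw [Function.comp_apply, hBb, cross_smul_right, inner_smul_left, inner_smul_left,
    inner_cross_self_right, mul_zero, mul_zero, add_zero] at h1
  exact h1

/-- The primitive of the parallel velocity converges to that of the guiding centre. -/
lemma continuouslyConverges_integral_parallel_velocity
    (hy : ∀ ω > 0, IsLorentzTrajectory B x₀ v₀ ω (y ω) (v ω)) (hb : ContDiff ℝ 1 b)
    (hb1 : ∀ y, ‖b y‖ = 1)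
    {x : ℝ → E3} {h : ℝ → ℝ} (hhc : Continuous h)
    (hxh : ∀ t, HasDerivAt x (h t • b (x t)) t) (hyx : ContinuouslyConverges y x) :
    ContinuouslyConverges (fun ω t => ∫ s in (0 : ℝ)..t, (⟪v ω s, b (y ω s)⟫ - h s))
      fun _ => 0 := by
  have hbc := hb.continuous
  have hDb : Continuous (fderiv ℝ b) := hb.continuous_fderiv one_ne_zero
  have hx : Continuous x := continuous_iff_continuousAt.mpr fun t => (hxh t).continuousAt
  have hβc : Continuous fun s => b (x s) := hbc.comp hx
  obtain ⟨c, hcc, hbx⟩ : ∃ c : ℝ → E3, Continuous c ∧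
      ∀ s, HasDerivAt (fun s => b (x s)) (c s) s :=
    ⟨fun s => fderiv ℝ b (x s) (h s • b (x s)), (hDb.comp hx).clm_apply (hhc.smul hβc),
      fun s => (hb.differentiable one_ne_zero (x s)).hasFDerivAt.comp_hasDerivAt s (hxh s)⟩
  have hyx0 : ContinuouslyConverges (fun ω t => y ω t - x t) fun _ => 0 := by
    simpa using hyx.sub (continuouslyConverges_const hx)
  have hR1 : ContinuouslyConverges (fun ω t => ⟪v ω t, b (y ω t) - b (x t)⟫) fun _ => 0 := by
    have h1 : ContinuouslyConverges (fun ω t => ‖v₀‖ * ‖b (y ω t) - b (x t)‖) fun _ => 0 := by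
      simpa using ((hyx.comp_continuous hbc).sub
        (continuouslyConverges_const hβc)).comp_continuous
          (φ := fun z => ‖v₀‖ * ‖z‖) (continuous_const.mul continuous_norm)
    refine continuouslyConverges_zero_of_norm_le h1 fun ω hω t => ?_
    rw [← (hy ω hω).norm_vel t]
    exact norm_inner_le_norm _ _
  have hR : ∀ c : ℝ → E3, Continuous c →
      ContinuouslyConverges (fun ω t => ⟪y ω t - x t, c t⟫) fun _ => 0 := fun c hcc => by
    simpa using (hyx0.prodMk (continuouslyConverges_const hcc)).comp_continuous
      (φ := fun z : E3 × E3 => ⟪z.1, z.2⟫) (continuous_fst.inner continuous_snd)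
  have c1 : ∀ ω > 0, Continuous fun s => ⟪v ω s, b (y ω s) - b (x s)⟫ := fun ω hω =>
    (hy ω hω).continuous_vel.inner ((hbc.comp (hy ω hω).continuous_pos).sub hβc)
  have c2 : ∀ ω > 0, Continuous fun s => ⟪y ω s - x s, c s⟫ := fun ω hω =>
    ((hy ω hω).continuous_pos.sub hx).inner hcc
  have c3 : ∀ ω > 0, Continuous fun s => ⟪v ω s - h s • b (x s), b (x s)⟫ := fun ω hω =>
    ((hy ω hω).continuous_vel.sub (hhc.smul hβc)).inner hβc
  have h2 := ((hR1.sub (hR c hcc)).integral (fun ω hω => (c1 ω hω).sub (c2 ω hω))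
    (continuous_const.sub continuous_const)).add ((hR _ hβc).sub ((hR _ hβc).eval 0))
  simp only [sub_zero, intervalIntegral.integral_zero, add_zero] at h2
  refine h2.congr' fun ω hω t => ?_
  have hder : ∀ s, HasDerivAt (fun s => ⟪y ω s - x s, b (x s)⟫)
      (⟪y ω s - x s, c s⟫ + ⟪v ω s - h s • b (x s), b (x s)⟫) s := fun s =>
    (((hy ω hω).hasDerivAt_pos s).sub (hxh s)).inner ℝ (hbx s)
  rw [← intervalIntegral.integral_eq_sub_of_hasDerivAt (fun s _ => hder s)
    (((c2 ω hω).fun_add (c3 ω hω)).intervalIntegrable _ _),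
    ← intervalIntegral.integral_add (((c1 ω hω).fun_sub (c2 ω hω)).intervalIntegrable _ _)
    (((c2 ω hω).fun_add (c3 ω hω)).intervalIntegrable _ _)]
  refine intervalIntegral.integral_congr fun s _ => ?_
  simp only [inner_sub_right, inner_sub_left, inner_smul_left, real_inner_self_eq_norm_sq, hb1]
  simp only [conj_trivial]
  ring

/-- The parallel velocity converges to the parallel velocity of the guiding centre. -/
lemma continuouslyConverges_parallel_velocity
    (hy : ∀ ω > 0, IsLorentzTrajectory B x₀ v₀ ω (y ω) (v ω)) (hb : ContDiff ℝ 1 b)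
    (hb1 : ∀ y, ‖b y‖ = 1) (hBb : ∀ y, B y = ‖B y‖ • b y)
    {x : ℝ → E3} {h : ℝ → ℝ} (hh : ContDiff ℝ 1 h)
    (hxh : ∀ t, HasDerivAt x (h t • b (x t)) t) (hyx : ContinuouslyConverges y x) :
    ContinuouslyConverges (fun ω t => ⟪v ω t, b (y ω t)⟫) h := by
  have hbc := hb.continuous
  have hhc := hh.continuous
  have hDb : Continuous (fderiv ℝ b) := hb.continuous_fderiv one_ne_zero
  have hbd := hb.differentiable one_ne_zero
  have huc : ∀ ω > 0, Continuous fun t => ⟪v ω t, b (y ω t)⟫ := fun ω hω =>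
    (hy ω hω).continuous_vel.inner (hbc.comp (hy ω hω).continuous_pos)
  have hI := continuouslyConverges_integral_parallel_velocity hy hb hb1 hhc hxh hyx
  have hd : ContinuouslyConverges (fun ω t => ⟪v ω t, b (y ω t)⟫ - h t) fun _ => 0 := by
    refine hI.of_integral (fun ω hω => (huc ω hω).sub hhc) fun T => ?_
    obtain ⟨C₁, hC₁⟩ := exists_bound_along hy
      (Ψ := fun p => ⟪p.2, fderiv ℝ b p.1 p.2⟫) (by fun_prop) T
    obtain ⟨C₂, hC₂⟩ := (isCompact_Icc (a := -T) (b := T)).exists_bound_of_continuousOn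
      (hh.continuous_deriv le_rfl).continuousOn
    refine ⟨C₁ + C₂, fun ω hω s t hs ht => ?_⟩
    have hder : ∀ r, HasDerivAt (fun r => ⟪v ω r, b (y ω r)⟫ - h r)
        (⟪v ω r, fderiv ℝ b (y ω r) (v ω r)⟫ - deriv h r) r := fun r =>
      ((hy ω hω).hasDerivAt_inner hbd hBb r).sub (hh.differentiable one_ne_zero r).hasDerivAt
    exact (convex_Icc (-T) T).norm_image_sub_le_of_norm_hasDerivWithin_le
      (fun r _ => (hder r).hasDerivWithinAt)
      (fun r hr => (norm_sub_le _ _).trans (add_le_add (hC₁ ω hω r (abs_le.mpr hr)) (hC₂ r hr)))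
      (abs_le.mp ht) (abs_le.mp hs)
  simpa using hd.add (continuouslyConverges_const hhc)

/-- The inner product as a continuous bilinear map. -/
def innerBilin : E3 →L[ℝ] E3 →L[ℝ] ℝ := (innerₗ E3).toContinuousBilinearMap

lemma innerBilin_apply (u w : E3) : innerBilin u w = ⟪u, w⟫ := rfl

lemma inner_fderiv_of_norm_eq_one (hb : Differentiable ℝ b) (hb1 : ∀ y, ‖b y‖ = 1) (y a : E3) :
    ⟪fderiv ℝ b y a, b y⟫ = 0 := by
  have h1 := (hb y).hasFDerivAt.inner ℝ (hb y).hasFDerivAt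
  have h2 : HasFDerivAt (fun z => ⟪b z, b z⟫) (0 : E3 →L[ℝ] ℝ) y := by
    simp only [real_inner_self_eq_norm_sq, hb1]; exact hasFDerivAt_const _ _
  have h3 := congrArg (fun L : E3 →L[ℝ] ℝ => L a) (h1.unique h2)
  simp [real_inner_comm] at h3
  rw [real_inner_comm]
  linarith

lemma divergence_smul {N : E3 → ℝ} (hN : Differentiable ℝ N) (hb : Differentiable ℝ b) (y : E3) :
    divergence (fun z => N z • b z) y = N y * divergence b y + fderiv ℝ N y (b y) := by
  have h1 := ((hN y).hasFDerivAt.smul (hb y).hasFDerivAt).fderiv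
  have h2 : fderiv ℝ N y (b y) = ∑ i, b y i * fderiv ℝ N y (EuclideanSpace.single i 1) := by
    conv_lhs => rw [eq_sum_smul_single (b y)]
    simp only [map_sum, map_smul, smul_eq_mul]
  have h3 : fderiv ℝ (fun z => N z • b z) y = N y • fderiv ℝ b y +
      (fderiv ℝ N y).smulRight (b y) := h1
  rw [h2, divergence, divergence, Finset.mul_sum, ← Finset.sum_add_distrib]
  refine Finset.sum_congr rfl fun i _ => ?_
  simp [pd, h3, mul_comm]

lemma gyroAverage_innerBilin_fderiv (hb : Differentiable ℝ b) (hb1 : ∀ y, ‖b y‖ = 1) (y : E3)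
    (u e : ℝ) : gyroAverage (innerBilin ∘L fderiv ℝ b y) (b y) u e =
      (e - u ^ 2) / 2 * divergence b y := by
  have h1 : (innerBilin ∘L fderiv ℝ b y) (b y) (b y) = 0 :=
    inner_fderiv_of_norm_eq_one hb hb1 y (b y)
  have h2 : bilinTrace (innerBilin ∘L fderiv ℝ b y) = divergence b y := by
    simp [bilinTrace, divergence, pd, innerBilin_apply, EuclideanSpace.inner_single_right]
  rw [gyroAverage, h1, h2]
  simp

/-- Conservation of the magnetic moment in the guiding-centre limit. -/
lemma magnetic_moment_conserved
    (hy : ∀ ω > 0, IsLorentzTrajectory B x₀ v₀ ω (y ω) (v ω)) (hB : ContDiff ℝ 1 B)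
    (hne : ∀ y, B y ≠ 0) (hdiv : ∀ y, divergence B y = 0) (hb : ContDiff ℝ 2 b)
    (hb1 : ∀ y, ‖b y‖ = 1) (hBb : ∀ y, B y = ‖B y‖ • b y)
    {x : ℝ → E3} {h : ℝ → ℝ} (hh : ContDiff ℝ 1 h)
    (hxh : ∀ t, HasDerivAt x (h t • b (x t)) t) (hyx : ContinuouslyConverges y x) (t : ℝ) :
    (‖v₀‖ ^ 2 - h t ^ 2) / (2 * ‖B (x t)‖) = (‖v₀‖ ^ 2 - h 0 ^ 2) / (2 * ‖B (x 0)‖) := by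
  have hb' : ContDiff ℝ 1 b := hb.of_le one_le_two
  have hbd := hb'.differentiable one_ne_zero
  have hx : Continuous x := continuous_iff_continuousAt.mpr fun t => (hxh t).continuousAt
  have hhc := hh.continuous
  have hbc := hb.continuous
  have hDbC : ContDiff ℝ 1 (fderiv ℝ b) := hb.fderiv_right (by norm_num)
  have hDb := hDbC.continuous
  have hM : ContDiff ℝ 1 fun y => innerBilin ∘L fderiv ℝ b y := contDiff_const.clm_comp hDbC
  have huh := continuouslyConverges_parallel_velocity hy hb' hb1 hBb hh hxh hyx
  have h1 := continuouslyConverges_integral_bilin hy hB hne hb' hb1 hBb hM hx hhc hyx huh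
  have h2 := (continuouslyConverges_const (continuous_const (y := ⟪v₀, b x₀⟫))).add h1
  have h3 := huh.unique (h2.congr' fun ω hω t => by
    have c1 := (hy ω hω).continuous_pos
    have c2 := (hy ω hω).continuous_vel
    have hder : ∀ r, HasDerivAt (fun r => ⟪v ω r, b (y ω r)⟫)
        ((innerBilin ∘L fderiv ℝ b (y ω r)) (v ω r) (v ω r)) r := fun r => by
      have h1 := (hy ω hω).hasDerivAt_inner hbd hBb r
      rwa [real_inner_comm] at h1
    rw [intervalIntegral.integral_eq_sub_of_hasDerivAt (fun s _ => hder s)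
      (Continuous.intervalIntegrable (by fun_prop) _ _), (hy ω hω).pos_zero, (hy ω hω).vel_zero]
    ring)
  simp only [gyroAverage_innerBilin_fderiv hbd hb1] at h3
  have hdc : Continuous (divergence b) := by
    change Continuous fun z => ∑ i, fderiv ℝ b z (EuclideanSpace.single i 1) i
    fun_prop
  have hhd : ∀ t, HasDerivAt h ((‖v₀‖ ^ 2 - h t ^ 2) / 2 * divergence b (x t)) t := fun t => by
    have hc : Continuous fun s => (‖v₀‖ ^ 2 - h s ^ 2) / 2 * divergence b (x s) := by fun_prop
    have := (hc.integral_hasStrictDerivAt 0 t).hasDerivAt.const_add ⟪v₀, b x₀⟫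
    rwa [← h3] at this
  have hNd : Differentiable ℝ fun z => ‖B z‖ := (hB.norm ℝ hne).differentiable one_ne_zero
  have hN0 : ∀ z, ‖B z‖ ≠ 0 := fun z => norm_ne_zero_iff.mpr (hne z)
  have hNb : ∀ z, fderiv ℝ (fun z => ‖B z‖) z (b z) = -(‖B z‖ * divergence b z) := fun z => by
    have := divergence_smul hNd hbd z
    simp only [← hBb] at this
    have h0 := hdiv z
    linarith
  have hNx : ∀ t, HasDerivAt (fun t => ‖B (x t)‖)
      (-(h t * (‖B (x t)‖ * divergence b (x t)))) t := fun t => by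
    have := (hNd (x t)).hasFDerivAt.comp_hasDerivAt t (hxh t)
    rw [map_smul, hNb, smul_eq_mul, mul_neg] at this
    exact this
  have hder : ∀ t, HasDerivAt (fun t => (‖v₀‖ ^ 2 - h t ^ 2) / (2 * ‖B (x t)‖)) 0 t := fun t => by
    have := (((hhd t).fun_pow 2).const_sub (‖v₀‖ ^ 2)).fun_div ((hNx t).const_mul 2)
      (mul_ne_zero two_ne_zero (hN0 _))
    refine this.congr_deriv ?_
    rw [div_eq_zero_iff]
    left
    push_cast
    ring
  exact is_const_of_deriv_eq_zero (fun s => (hder s).differentiableAt)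
    (fun s => (hder s).deriv) t 0

end Trajectory

section VectorCalculus

variable {b : E3 → E3}

/-- The part of the curl of a unit vector field orthogonal to the field is given by its
curvature. -/
lemma curl_eq_of_norm_eq_one (hb : Differentiable ℝ b) (hb1 : ∀ y, ‖b y‖ = 1) (y : E3) :
    curl b y = ⟪b y, curl b y⟫ • b y + cross (b y) (fderiv ℝ b y (b y)) := by
  have h1 : b y 0 * b y 0 + b y 1 * b y 1 + b y 2 * b y 2 = 1 := by
    rw [← norm_sq_eq_coord, hb1, one_pow]
  have hw : ∀ i, pd b i y 0 * b y 0 + pd b i y 1 * b y 1 + pd b i y 2 * b y 2 = 0 := fun i => by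
    rw [← inner_eq_coord]
    exact inner_fderiv_of_norm_eq_one hb hb1 y _
  have hκ : fderiv ℝ b y (b y) = b y 0 • pd b 0 y + b y 1 • pd b 1 y + b y 2 • pd b 2 y := by
    conv_lhs => rw [eq_sum_smul_single (b y)]
    simp only [map_sum, map_smul]
    simp only [Fin.sum_univ_three, pd]
  rw [hκ]
  ext i
  fin_cases i <;> simp [curl, inner_eq_coord, cross]
  · linear_combination -(pd b 1 y 2 - pd b 2 y 1) * h1 - b y 1 * hw 2 + b y 2 * hw 1
  · linear_combination -(pd b 2 y 0 - pd b 0 y 2) * h1 - b y 2 * hw 0 + b y 0 * hw 2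
  · linear_combination -(pd b 0 y 1 - pd b 1 y 0) * h1 - b y 0 * hw 1 + b y 1 * hw 0

lemma continuous_inner_curl (hb : ContDiff ℝ 1 b) : Continuous fun z => ⟪b z, curl b z⟫ := by
  have hbc := hb.continuous
  have hDb : Continuous (fderiv ℝ b) := hb.continuous_fderiv one_ne_zero
  simp only [inner_eq_coord, curl, pd, Matrix.cons_val]
  fun_prop

lemma bilinTrace_crossL_comp_fderiv (f : E3 → E3) (y : E3) :
    bilinTrace (crossL ∘L fderiv ℝ f y) = -curl f y := by
  change ∑ i, cross (pd f i y) (EuclideanSpace.single i 1) = _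
  ext i
  fin_cases i <;> simp [Fin.sum_univ_three, cross, curl] <;> ring

lemma fderiv_inv_smul_apply {N : E3 → ℝ} (hN : Differentiable ℝ N) (hN0 : ∀ y, N y ≠ 0)
    (hb : Differentiable ℝ b) (y a : E3) :
    fderiv ℝ (fun z => (N z)⁻¹ • b z) y a =
      (N y)⁻¹ • fderiv ℝ b y a - ((N y ^ 2)⁻¹ * fderiv ℝ N y a) • b y := by
  have h0 : HasFDerivAt (fun z => (N z)⁻¹) (-(N y ^ 2)⁻¹ • fderiv ℝ N y) y :=
    (hasDerivAt_inv (hN0 y)).comp_hasFDerivAt y (hN y).hasFDerivAt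
  have h1 := h0.fun_smul (hb y).hasFDerivAt
  rw [h1.fderiv]
  simp [sub_eq_add_neg]

lemma inner_gradient {N : E3 → ℝ} (hN : Differentiable ℝ N) (y a : E3) :
    ⟪gradient N y, a⟫ = fderiv ℝ N y a := by
  rw [(hN y).hasGradientAt.hasFDerivAt.fderiv, InnerProductSpace.toDual_apply_apply]

lemma curl_inv_smul {N : E3 → ℝ} (hN : Differentiable ℝ N) (hN0 : ∀ y, N y ≠ 0)
    (hb : Differentiable ℝ b) (y : E3) :
    curl (fun z => (N z)⁻¹ • b z) y =
      (N y)⁻¹ • curl b y + (N y ^ 2)⁻¹ • cross (b y) (gradient N y) := by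
  have hg : ∀ i, fderiv ℝ N y (EuclideanSpace.single i 1) = gradient N y i := fun i => by
    rw [← inner_gradient hN, EuclideanSpace.inner_single_right]; simp
  ext i
  fin_cases i <;> simp [curl, pd, cross, fderiv_inv_smul_apply hN hN0 hb, hg] <;> ring

/-- The gyroaveraged perpendicular drift is the sum of the gradient drift, the curvature drift and
a drift along the field. -/
lemma gyroAverage_drift {N : E3 → ℝ} (hN : Differentiable ℝ N) (hN0 : ∀ y, N y ≠ 0)
    (hb : Differentiable ℝ b) (hb1 : ∀ y, ‖b y‖ = 1) (y : E3) {u e μ : ℝ}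
    (hμ : (e - u ^ 2) / 2 = μ * N y) :
    gyroAverage (crossL ∘L fderiv ℝ (fun z => (N z)⁻¹ • b z) y) (b y) u e
      + (μ * ⟪b y, curl b y⟫) • b y
      + cross ((N y)⁻¹ • b y) (μ • gradient N y + u ^ 2 • fderiv ℝ b y (b y)) = 0 := by
  have hbb : (crossL ∘L fderiv ℝ (fun z => (N z)⁻¹ • b z) y) (b y) (b y) =
      -((N y)⁻¹ • cross (b y) (fderiv ℝ b y (b y))) := by
    change cross (fderiv ℝ (fun z => (N z)⁻¹ • b z) y (b y)) (b y) = _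
    rw [fderiv_inv_smul_apply hN hN0 hb]
    ext i
    fin_cases i <;> simp [cross] <;> ring
  rw [gyroAverage, bilinTrace_crossL_comp_fderiv, curl_inv_smul hN hN0 hb, hbb, hμ,
    curl_eq_of_norm_eq_one hb hb1 y]
  have := hN0 y
  set κ := fderiv ℝ b y (b y)
  have hc : ⟪b y, ⟪b y, curl b y⟫ • b y + cross (b y) κ⟫ = ⟪b y, curl b y⟫ := by
    rw [inner_add_right, inner_smul_right, inner_cross_self_left, real_inner_self_eq_norm_sq, hb1]
    simp
  rw [hc, cross_smul_left, ← crossL_apply _ (_ + _), map_add, map_smul, map_smul]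
  simp only [crossL_apply]
  match_scalars <;> field_simp <;> ring

end VectorCalculus

section Drift

variable {B b : E3 → E3} {x₀ v₀ : E3}

/-- The exact expansion of the position into the motion along the field and the drift. -/
lemma IsLorentzTrajectory.smul_pos_sub {ω : ℝ} {y v : ℝ → E3}
    (hy : IsLorentzTrajectory B x₀ v₀ ω y v) (hne : ∀ y, B y ≠ 0) (hb : Continuous b)
    (hb1 : ∀ y, ‖b y‖ = 1) (hBb : ∀ y, B y = ‖B y‖ • b y)
    (hg : ContDiff ℝ 1 fun z => ‖B z‖⁻¹ • b z) (t : ℝ) :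
    ω • (y t - x₀) = ω • (∫ s in (0 : ℝ)..t, ⟪v s, b (y s)⟫ • b (y s))
      + cross (‖B (y t)‖⁻¹ • b (y t)) (v t) - cross (‖B x₀‖⁻¹ • b x₀) v₀
      - ∫ s in (0 : ℝ)..t,
          (crossL ∘L fderiv ℝ (fun z => ‖B z‖⁻¹ • b z) (y s)) (v s) (v s) := by
  have c1 := hy.continuous_pos
  have c2 := hy.continuous_vel
  set g : E3 → E3 := fun z => ‖B z‖⁻¹ • b z with hgdef
  have hDg : Continuous (fderiv ℝ g) := hg.continuous_fderiv one_ne_zero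
  have cM : Continuous fun s => (crossL ∘L fderiv ℝ g (y s)) (v s) (v s) :=
    (((continuous_const (y := crossL)).clm_comp (hDg.comp c1)).clm_apply c2).clm_apply c2
  have cu : Continuous fun s => ⟪v s, b (y s)⟫ • b (y s) :=
    (c2.inner (hb.comp c1)).fun_smul (hb.comp c1)
  have hcross : ∀ s, crossL (g (y s)) (ω • cross (v s) (B (y s))) =
      ω • (v s - ⟪v s, b (y s)⟫ • b (y s)) := fun s => by
    have hN : ‖B (y s)‖ ≠ 0 := norm_ne_zero_iff.mpr (hne _)
    rw [map_smul, crossL_apply, hBb (y s), cross_smul_right, cross_smul_right, hgdef]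
    simp only [cross_smul_left, cross_cross_left, hb1]
    rw [smul_inv_smul₀ hN]
    simp
  have hder : ∀ s, HasDerivAt (fun s => crossL (g (y s)) (v s))
      ((crossL ∘L fderiv ℝ g (y s)) (v s) (v s) +
        ω • (v s - ⟪v s, b (y s)⟫ • b (y s))) s := fun s => by
    have h1 : HasDerivAt (fun s => g (y s)) (fderiv ℝ g (y s) (v s)) s :=
      (hg.differentiable one_ne_zero (y s)).hasFDerivAt.comp_hasDerivAt s (hy.hasDerivAt_pos s)
    have h2 : HasDerivAt (fun s => crossL (g (y s))) (crossL (fderiv ℝ g (y s) (v s))) s :=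
      crossL.hasFDerivAt.comp_hasDerivAt s h1
    have h3 := h2.clm_apply (hy.hasDerivAt_vel s)
    rwa [hcross] at h3
  have hI := intervalIntegral.integral_eq_sub_of_hasDerivAt (a := 0) (b := t) (fun s _ => hder s)
    ((cM.fun_add ((c2.fun_sub cu).const_smul ω)).intervalIntegrable _ _)
  have hv := intervalIntegral.integral_eq_sub_of_hasDerivAt (a := 0) (b := t)
    (fun s _ => hy.hasDerivAt_pos s) (c2.intervalIntegrable _ _)
  have cs : Continuous fun s => ω • (v s - ⟪v s, b (y s)⟫ • b (y s)) :=
    (c2.fun_sub cu).const_smul ω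
  rw [intervalIntegral.integral_add (cM.intervalIntegrable _ _) (cs.intervalIntegrable _ _),
    intervalIntegral.integral_smul, intervalIntegral.integral_sub (c2.intervalIntegrable _ _)
    (cu.intervalIntegrable _ _), hv, hy.pos_zero, hy.vel_zero, crossL_apply, crossL_apply] at hI
  simp only [hgdef] at hI ⊢
  rw [add_sub_assoc, ← hI]
  module

/-- The drift converges to the sum of the gradient and curvature drifts and a drift along the
field. -/
lemma continuouslyConverges_drift {y v : ℝ → ℝ → E3}
    (hy : ∀ ω > 0, IsLorentzTrajectory B x₀ v₀ ω (y ω) (v ω)) (hB : ContDiff ℝ 2 B)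
    (hne : ∀ y, B y ≠ 0) (hdiv : ∀ y, divergence B y = 0) (hb : ContDiff ℝ 2 b)
    (hb1 : ∀ y, ‖b y‖ = 1) (hBb : ∀ y, B y = ‖B y‖ • b y)
    {x : ℝ → E3} {h : ℝ → ℝ} (hh : ContDiff ℝ 1 h)
    (hxh : ∀ t, HasDerivAt x (h t • b (x t)) t) (hyx : ContinuouslyConverges y x)
    {μ : ℝ} (hμ : μ = (‖v₀‖ ^ 2 - h 0 ^ 2) / (2 * ‖B (x 0)‖)) :
    ContinuouslyConverges (fun ω t =>
      cross (‖B (y ω t)‖⁻¹ • b (y ω t)) (v ω t) - cross (‖B (x t)‖⁻¹ • b (x t)) (v ω t)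
      - ((∫ s in (0 : ℝ)..t,
          (crossL ∘L fderiv ℝ (fun z => ‖B z‖⁻¹ • b z) (y ω s)) (v ω s) (v ω s))
        + (∫ s in (0 : ℝ)..t, (μ * ⟪b (x s), curl b (x s)⟫) • b (y ω s))
        + ∫ s in (0 : ℝ)..t, cross (‖B (x s)‖⁻¹ • b (y ω s))
            (μ • gradient (fun z => ‖B z‖) (x s) + h s ^ 2 • fderiv ℝ b (x s) (b (x s)))))
      fun _ => 0 := by
  have hB1 : ContDiff ℝ 1 B := hB.of_le one_le_two
  have hb' : ContDiff ℝ 1 b := hb.of_le one_le_two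
  have hbd := hb'.differentiable one_ne_zero
  have hbc := hb.continuous
  have hhc := hh.continuous
  have hx : Continuous x := continuous_iff_continuousAt.mpr fun t => (hxh t).continuousAt
  have hN0 : ∀ z, ‖B z‖ ≠ 0 := fun z => norm_ne_zero_iff.mpr (hne z)
  have hN : ContDiff ℝ 2 fun z => ‖B z‖ := hB.norm ℝ hne
  have hNd : Differentiable ℝ fun z => ‖B z‖ := hN.differentiable two_ne_zero
  have hNi : Continuous fun z => ‖B z‖⁻¹ := hN.continuous.inv₀ hN0
  have hg : ContDiff ℝ 2 fun z => ‖B z‖⁻¹ • b z := (hN.inv hN0).smul hb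
  have hM : ContDiff ℝ 1 fun z => crossL ∘L fderiv ℝ (fun z => ‖B z‖⁻¹ • b z) z :=
    contDiff_const.clm_comp (hg.fderiv_right (by norm_num))
  have hDb : Continuous (fderiv ℝ b) := hb.continuous_fderiv two_ne_zero
  have hgrad : Continuous (gradient fun z => ‖B z‖) :=
    (InnerProductSpace.toDual ℝ E3).symm.continuous.comp (hN.continuous_fderiv two_ne_zero)
  have huh := continuouslyConverges_parallel_velocity hy hb' hb1 hBb hh hxh hyx
  have hbyx := hyx.comp_continuous hbc
  have hcurlx : Continuous fun s => μ * ⟪b (x s), curl b (x s)⟫ :=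
    continuous_const.mul ((continuous_inner_curl hb').comp hx)
  have hwx : Continuous fun s => μ • gradient (fun z => ‖B z‖) (x s) +
      h s ^ 2 • fderiv ℝ b (x s) (b (x s)) := by
    have := hgrad.comp hx
    fun_prop
  have hNx : Continuous fun s => ‖B (x s)‖⁻¹ := hNi.comp hx
  have c1 : Continuous fun p : ℝ × E3 => p.1 • p.2 := continuous_fst.smul continuous_snd
  have c2 : Continuous fun p : (ℝ × E3) × E3 => cross (p.1.1 • p.1.2) p.2 := by
    simp only [← crossL_apply]; fun_prop
  have hI0 : ContinuouslyConverges (fun ω t =>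
      cross (‖B (y ω t)‖⁻¹ • b (y ω t)) (v ω t) - cross (‖B (x t)‖⁻¹ • b (x t)) (v ω t))
      fun _ => 0 := by
    have h1 : ContinuouslyConverges (fun ω t => ‖crossL‖ *
        ‖‖B (y ω t)‖⁻¹ • b (y ω t) - ‖B (x t)‖⁻¹ • b (x t)‖ * ‖v₀‖) fun _ => 0 := by
      simpa using ((hyx.comp_continuous hg.continuous).sub
        (continuouslyConverges_const (hg.continuous.comp hx))).comp_continuous
          (φ := fun z => ‖crossL‖ * ‖z‖ * ‖v₀‖)
          ((continuous_const.mul continuous_norm).mul continuous_const)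
    refine continuouslyConverges_zero_of_norm_le h1 fun ω hω t => ?_
    rw [← (hy ω hω).norm_vel t, ← crossL_apply, ← crossL_apply, ← sub_apply, ← map_sub]
    exact crossL.le_opNorm₂ _ _
  have hI1 := continuouslyConverges_integral_bilin hy hB1 hne hb' hb1 hBb hM hx hhc hyx huh
  have hI2 := ((((continuouslyConverges_const hcurlx).prodMk hbyx).comp_continuous c1).integral
    (fun ω hω => hcurlx.smul (hbc.comp (hy ω hω).continuous_pos)) (hcurlx.smul (hbc.comp hx)))
  have hI3 := (((((continuouslyConverges_const hNx).prodMk hbyx).prodMk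
    (continuouslyConverges_const hwx)).comp_continuous c2).integral
    (fun ω hω => c2.comp ((hNx.prodMk (hbc.comp (hy ω hω).continuous_pos)).prodMk hwx))
    (c2.comp ((hNx.prodMk (hbc.comp hx)).prodMk hwx)))
  have hI := hI0.sub ((hI1.add hI2).add hI3)
  convert hI using 1
  funext t
  have cav : Continuous fun s => gyroAverage
      (crossL ∘L fderiv ℝ (fun z => ‖B z‖⁻¹ • b z) (x s)) (b (x s)) (h s) (‖v₀‖ ^ 2) :=
    continuous_gyroAverage (hM.continuous.comp hx) (hbc.comp hx) hhc _
  have i2 := (hcurlx.smul (hbc.comp hx)).intervalIntegrable (μ := volume) 0 t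
  have i3 := (c2.comp ((hNx.prodMk (hbc.comp hx)).prodMk hwx)).intervalIntegrable
    (μ := volume) 0 t
  rw [zero_sub, eq_comm, neg_eq_zero]
  erw [← intervalIntegral.integral_add (cav.intervalIntegrable _ _) i2,
    ← intervalIntegral.integral_add ((cav.intervalIntegrable _ _).add i2) i3]
  rw [← intervalIntegral.integral_zero (a := 0) (b := t) (μ := volume) (E := E3)]
  refine intervalIntegral.integral_congr fun s _ => ?_
  refine gyroAverage_drift hNd hN0 hbd hb1 (x s) ?_
  rw [hμ, ← magnetic_moment_conserved hy hB1 hne hdiv hb hb1 hBb hh hxh hyx s]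
  have := hN0 (x s)
  field_simp

end Drift

lemma HolderLocConv.continuouslyConverges {f : ℝ → ℝ → E3} {g : ℝ → E3} {α : ℝ}
    (hf : HolderLocConv f g α) (hg : Continuous g) : ContinuouslyConverges f g := by
  have h0 : ContinuouslyConverges (fun ω t => f ω t - g t) fun _ => 0 := fun t => by
    rw [Metric.tendsto_nhds]
    intro η hη
    obtain ⟨W, hW⟩ := hf (Metric.closedBall t 1) (isCompact_closedBall t 1) (η / 2) (half_pos hη)
    filter_upwards [prod_mem_prod (Ici_mem_atTop W) (Metric.closedBall_mem_nhds t one_pos)]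
      with p hp
    rw [dist_zero_right]
    exact ((hW p.1 hp.1).1 p.2 hp.2).trans_lt (half_lt_self hη)
  simpa using h0.add (continuouslyConverges_const hg)

/-- Theorem 1.2 (first order expansion of the full particle trajectory). -/
theorem stmt7 (B : E3 → E3) (hB : ContDiff ℝ 2 B) (hne : ∀ y : E3, B y ≠ 0)
    (hdiv : ∀ y : E3, divergence B y = 0) (x₀ v₀ : E3)
    (b : E3 → E3) (hb : b = fun y => ‖B y‖⁻¹ • B y)
    (xω : ℝ → ℝ → E3)
    (hxC : ∀ ω > (0:ℝ), ContDiff ℝ 2 (xω ω))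
    (hode : ∀ ω > (0:ℝ), ∀ t : ℝ,
      deriv (deriv (xω ω)) t = ω • cross (deriv (xω ω) t) (B (xω ω t)))
    (hinit : ∀ ω > (0:ℝ), xω ω 0 = x₀ ∧ deriv (xω ω) 0 = v₀)
    (x : ℝ → E3) (h : ℝ → ℝ) (hx3 : ContDiff ℝ 3 x) (hh2 : ContDiff ℝ 2 h)
    (hconv : ∀ α : ℝ, 0 ≤ α → α < 1 → HolderLocConv xω x α)
    (hxh : ∀ t : ℝ, deriv x t = h t • b (x t))
    (μ₀ : ℝ) (hμ₀ : μ₀ = (‖v₀‖ ^ 2 - h 0 ^ 2) / (2 * ‖B x₀‖))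
    (κ : E3 → E3) (hκ : κ = fun y => fderiv ℝ b y (b y)) :
    ∃ ε : ℝ → ℝ → ℝ, ∃ δ : ℝ → ℝ → E3, ∃ r : ℝ → ℝ → E3,
      TendstoLocallyUniformly ε (fun _ => (0:ℝ)) atTop ∧
      TendstoLocallyUniformly δ (fun _ => (0:E3)) atTop ∧
      TendstoLocallyUniformly (fun ω t => ω • r ω t) (fun _ => (0:E3)) atTop ∧
      ∀ ω > (0:ℝ), ∀ t : ℝ,
        xω ω t = x₀ + (∫ s in (0:ℝ)..t, (h s + ε ω s) • b (xω ω s))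
          + (ω * ‖B (x t)‖)⁻¹ • cross (b (x t)) (deriv (xω ω) t)
          + ω⁻¹ • (‖B x₀‖⁻¹ • cross v₀ (b x₀)
            + ∫ s in (0:ℝ)..t, cross (‖B (x s)‖⁻¹ • b (xω ω s))
                (μ₀ • gradient (fun y => ‖B y‖) (x s) + h s ^ 2 • κ (x s) + δ ω s))
          + r ω t := by
  have hne' : ∀ y, ‖B y‖ ≠ 0 := fun y => norm_ne_zero_iff.mpr (hne y)
  have hN : ContDiff ℝ 2 fun z => ‖B z‖ := hB.norm ℝ hne
  have hbC : ContDiff ℝ 2 b := hb ▸ (hN.inv hne').smul hB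
  have hb1 : ∀ y, ‖b y‖ = 1 := fun y => by
    rw [hb, norm_smul, norm_inv, norm_norm, inv_mul_cancel₀ (hne' y)]
  have hBb : ∀ y, B y = ‖B y‖ • b y := fun y => by
    simp only [hb]
    rw [smul_smul, mul_inv_cancel₀ (hne' y), one_smul]
  have hbc := hbC.continuous
  have hhc := hh2.continuous
  have hh1 : ContDiff ℝ 1 h := hh2.of_le one_le_two
  have hxd : ∀ t, HasDerivAt x (h t • b (x t)) t := fun t => by
    rw [← hxh]
    exact (hx3.differentiable three_ne_zero t).hasDerivAt
  have hy : ∀ ω > 0, IsLorentzTrajectory B x₀ v₀ ω (xω ω) (deriv (xω ω)) := fun ω hω =>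
    { hasDerivAt_pos := fun t => ((hxC ω hω).differentiable two_ne_zero t).hasDerivAt
      hasDerivAt_vel := fun t => by
        rw [← hode ω hω]
        exact (((hxC ω hω).iterate_deriv' 1 1).differentiable one_ne_zero t).hasDerivAt
      pos_zero := (hinit ω hω).1
      vel_zero := (hinit ω hω).2 }
  have hyx : ContinuouslyConverges xω x := (hconv 0 le_rfl one_pos).continuouslyConverges
    hx3.continuous
  have hx0 : x 0 = x₀ := by
    have h1 := (hyx.eval 0).congr' (G' := fun _ _ => x₀) fun ω hω _ => (hy ω hω).pos_zero
    exact congrFun (h1.unique (continuouslyConverges_const continuous_const)) 0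
  have hμ : μ₀ = (‖v₀‖ ^ 2 - h 0 ^ 2) / (2 * ‖B (x 0)‖) := by rw [hx0, hμ₀]
  have hg : ContDiff ℝ 1 fun z => ‖B z‖⁻¹ • b z :=
    ((hN.inv hne').smul hbC).of_le one_le_two
  have hcx : Continuous fun s => μ₀ * ⟪b (x s), curl b (x s)⟫ :=
    continuous_const.mul ((continuous_inner_curl (hbC.of_le one_le_two)).comp hx3.continuous)
  have hu := continuouslyConverges_parallel_velocity hy (hbC.of_le one_le_two) hb1 hBb hh1 hxd hyx
  have hdrift := continuouslyConverges_drift hy hB hne hdiv hbC hb1 hBb hh1 hxd hyx hμ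
  set ε : ℝ → ℝ → ℝ := fun ω s => ⟪deriv (xω ω) s, b (xω ω s)⟫ - h s
    + ω⁻¹ * (μ₀ * ⟪b (x s), curl b (x s)⟫) with hε
  set A : ℝ → ℝ → E3 := fun ω t =>
    x₀ + (∫ s in (0:ℝ)..t, (h s + ε ω s) • b (xω ω s))
      + (ω * ‖B (x t)‖)⁻¹ • cross (b (x t)) (deriv (xω ω) t)
      + ω⁻¹ • (‖B x₀‖⁻¹ • cross v₀ (b x₀)
        + ∫ s in (0:ℝ)..t, cross (‖B (x s)‖⁻¹ • b (xω ω s))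
            (μ₀ • gradient (fun y => ‖B y‖) (x s) + h s ^ 2 • κ (x s) + (0 : E3))) with hA
  refine ⟨ε, fun _ _ => 0, fun ω t => xω ω t - A ω t, ?_, ?_, ?_, fun ω _ t => ?_⟩
  · have hinv : ContinuouslyConverges (fun ω _ => ω⁻¹) fun _ => 0 := fun t =>
      tendsto_inv_atTop_zero.comp tendsto_fst
    have h1 := (hinv.prodMk (continuouslyConverges_const hcx)).comp_continuous
      (φ := fun p : ℝ × ℝ => p.1 * p.2) (continuous_fst.mul continuous_snd)
    have h2 := (hu.sub (continuouslyConverges_const hhc)).add h1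
    simp only [sub_self, zero_mul, add_zero] at h2
    exact h2.tendstoLocallyUniformly_zero
  · exact (continuouslyConverges_const continuous_const).tendstoLocallyUniformly_zero
  · refine (hdrift.congr' fun ω hω t => ?_).tendstoLocallyUniformly_zero
    have c1 := hbc.comp (hy ω hω).continuous_pos
    have cu : Continuous fun s => ⟪deriv (xω ω) s, b (xω ω s)⟫ • b (xω ω s) :=
      ((hy ω hω).continuous_vel.inner c1).fun_smul c1
    have cc : Continuous fun s => (μ₀ * ⟪b (x s), curl b (x s)⟫) • b (xω ω s) := hcx.fun_smul c1
    have hsplit : ∫ s in (0:ℝ)..t, (h s + ε ω s) • b (xω ω s) =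
        (∫ s in (0:ℝ)..t, ⟪deriv (xω ω) s, b (xω ω s)⟫ • b (xω ω s)) +
          ω⁻¹ • ∫ s in (0:ℝ)..t, (μ₀ * ⟪b (x s), curl b (x s)⟫) • b (xω ω s) := by
      rw [← intervalIntegral.integral_smul, ← intervalIntegral.integral_add
        (cu.intervalIntegrable _ _) ((cc.fun_const_smul ω⁻¹).intervalIntegrable _ _)]
      refine intervalIntegral.integral_congr fun s _ => ?_
      simp only [hε, smul_smul, ← add_smul]
      congr 1
      ring
    have hpos := (hy ω hω).smul_pos_sub hne hbc hb1 hBb hg t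
    have hanti : cross v₀ (b x₀) = -cross (b x₀) v₀ := cross_eq_neg_cross _ _
    rw [smul_sub, sub_eq_iff_eq_add] at hpos
    simp only [hA, hsplit, hκ, add_zero, hanti, smul_sub, smul_add, hpos, mul_inv, mul_smul,
      cross_smul_left, smul_inv_smul₀ hω.ne']
    module
  · simp only [hA, add_sub_cancel]
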